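/- Let n ≥ 3 be an even integer, n − 1 < β < α ≤ ⌈α⌉ = n, a > 0, and let f : ℝ → ℝ, q : [0,∞) → ℝ, g : [0,∞) → ℝ be continuous satisfying (G1) x·f(x) > 0 for all x ≠ 0, (G2) there exist c_1, η > 0 with |f(x)| ≥ c_1|x|^η for all |x| ≥ 1, (G3) there exist c_2 > 0 and μ ∈ (0, (n−2)/(n−β)) with |f(x)| ≥ c_2|x|^μ for all |x| < 1, (H) there exist T_1 > 0 and c_3 > 0 with q(t) ≥ c_3 for all t ≥ T_1, and (K) there exist σ ∈ (n−β,1), c_4 > 0 and T_2 > 0 with g(t) ≥ c_4 t^{n−β−σ} for all t ≥ T_2. Let x be an eventually positive solution on [0,∞) of (^C D^α_{0^+} x)(t) + a·(^C D^β_{0^+} x)(t) + q(t)·f(x(t)) + sgn(x(t))·g(t) = 0, t > 0, with x(0) = x_0, x^{(i)}(0) = x_i for i = 1,…,n−1, and let y_1,…,y_n be the associated functions. If for all t large enough y_1(t) > 0, y_2(t) > 0, and (−1)^i y_i(t) > 0 for i = 3,…,n, then the limit lim_{t→∞} y_1(t) exists and is finite. -/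

import Mathlib

open MeasureTheory Filter Set

noncomputable def fracInt (γ : ℝ) (f : ℝ → ℝ) (t : ℝ) : ℝ :=
  (1 / Real.Gamma γ) * ∫ s in (0:ℝ)..t, (t - s) ^ (γ - 1) * f s

noncomputable def taylorPolyAt0 (n : ℕ) (f : ℝ → ℝ) (t : ℝ) : ℝ :=
  ∑ k ∈ Finset.range n, iteratedDeriv k f 0 / (Nat.factorial k : ℝ) * t ^ k

noncomputable def caputoD (γ : ℝ) (f : ℝ → ℝ) : ℝ → ℝ :=
  iteratedDeriv ⌈γ⌉₊
    (fun t => fracInt ((⌈γ⌉₊ : ℝ) - γ) (fun s => f s - taylorPolyAt0 ⌈γ⌉₊ f s) t)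

def ContCaputoDiffOnIci (γ : ℝ) (f : ℝ → ℝ) : Prop :=
  ContDiffOn ℝ (⌈γ⌉₊ - 1 : ℕ) f (Set.Ici 0) ∧ ContinuousOn (caputoD γ f) (Set.Ici 0)

def Oscillatory (x : ℝ → ℝ) : Prop :=
  ∃ u : ℕ → ℝ, (∀ n, 0 ≤ u n) ∧ Filter.Tendsto u Filter.atTop Filter.atTop ∧ ∀ n, x (u n) = 0

noncomputable def assocY (n : ℕ) (α β a : ℝ) (ξ : ℕ → ℝ) (x : ℝ → ℝ) : ℕ → ℝ → ℝ
  | 1 => fun t => fracInt ((n : ℝ) - α) x t + a * fracInt ((n : ℝ) - β) x t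
  | 2 => fun t => caputoD (α - n + 1) x t + a * caputoD (β - n + 1) x t
      + ξ 0 * t ^ ((n : ℝ) - α - 1) / Real.Gamma ((n : ℝ) - α)
      + a * ξ 0 * t ^ ((n : ℝ) - β - 1) / Real.Gamma ((n : ℝ) - β)
  | i => fun t => caputoD (α - n - 1 + i) x t + a * caputoD (β - n - 1 + i) x t
      + (∑ k ∈ Finset.range (i - 1), ξ k *
          (∏ j ∈ Finset.range (i - 1 - k), ((n : ℝ) - α - i + 2 + k + j)) *
          t ^ ((n : ℝ) - α - i + 1 + k) / Real.Gamma ((n : ℝ) - α + 1))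
      + (∑ k ∈ Finset.range (i - 1), a * ξ k *
          (∏ j ∈ Finset.range (i - 1 - k), ((n : ℝ) - β - i + 2 + k + j)) *
          t ^ ((n : ℝ) - β - i + 1 + k) / Real.Gamma ((n : ℝ) - β + 1))

def AbsContOnInterval (f : ℝ → ℝ) (A B : ℝ) : Prop :=
  ∀ ε > (0:ℝ), ∃ δ > (0:ℝ), ∀ m : ℕ, ∀ s t : ℕ → ℝ,
    (∀ i < m, A ≤ s i ∧ s i ≤ t i ∧ t i ≤ B) →
    (∀ i < m, ∀ j < m, i ≠ j → Disjoint (Set.Ioo (s i) (t i)) (Set.Ioo (s j) (t j))) →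
    (∑ i ∈ Finset.range m, (t i - s i)) < δ →
    (∑ i ∈ Finset.range m, |f (t i) - f (s i)|) < ε

lemma hasDerivAt_kernel_primitive {γ η r u : ℝ} (hγ : 0 < γ) (hη : 0 < η) (hu : 0 ≤ u)
    (hur : u < r) :
    HasDerivAt (fun u => -(((r - u) / (u + η)) ^ γ / (γ * (r + η))))
      ((r - u) ^ (γ - 1) * (u + η) ^ (-γ - 1)) u := by
  have hz : 0 < (r - u) / (u + η) := div_pos (by linarith) (by linarith)
  have h1 : HasDerivAt (fun u => (r - u) / (u + η))
      (((-1) * (u + η) - (r - u) * 1) / (u + η) ^ 2) u :=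
    ((hasDerivAt_id u).const_sub r).div ((hasDerivAt_id u).add_const η) (by simp; linarith)
  have h2 := ((h1.rpow_const (p := γ) (Or.inl hz.ne')).div_const (γ * (r + η))).neg
  refine h2.congr_deriv ?_
  have hp : 0 < u + η := by linarith
  have hq : 0 < r + η := by linarith
  rw [Real.div_rpow (by linarith) hp.le,
    show -γ - 1 = -(γ - 1) - (2 : ℕ) by push_cast; ring, Real.rpow_sub_natCast hp.ne',
    Real.rpow_neg hp.le]
  have := (Real.rpow_pos_of_pos hp (γ - 1)).ne'
  field_simp
  ring

lemma continuousOn_kernel_primitive {γ η r : ℝ} (hγ : 0 < γ) (hη : 0 < η) :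
    ContinuousOn (fun u => -(((r - u) / (u + η)) ^ γ / (γ * (r + η)))) (Icc 0 r) := by
  have : ContinuousOn (fun u => (r - u) / (u + η)) (Icc 0 r) :=
    ContinuousOn.div (by fun_prop) (by fun_prop) (fun u hu => by have := hu.1; positivity)
  exact ((this.rpow_const (fun _ _ => Or.inr hγ.le)).div_const _).neg

lemma intervalIntegrable_kernel {γ η r : ℝ} (hγ : 0 < γ) (hη : 0 < η) (hr : 0 ≤ r) :
    IntervalIntegrable (fun u => (r - u) ^ (γ - 1) * (u + η) ^ (-γ - 1)) volume 0 r := by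
  rw [intervalIntegrable_iff_integrableOn_Ioc_of_le hr]
  refine intervalIntegral.integrableOn_deriv_of_nonneg (continuousOn_kernel_primitive hγ hη)
    (fun u hu => hasDerivAt_kernel_primitive hγ hη hu.1.le hu.2) (fun u hu => ?_)
  have h1 : 0 ≤ r - u := by linarith [hu.2]
  have h2 : 0 ≤ u + η := by linarith [hu.1]
  positivity

lemma integral_kernel {γ η r : ℝ} (hγ : 0 < γ) (hη : 0 < η) (hr : 0 ≤ r) :
    ∫ u in (0:ℝ)..r, (r - u) ^ (γ - 1) * (u + η) ^ (-γ - 1) = (r / η) ^ γ / (γ * (r + η)) := by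
  rw [intervalIntegral.integral_eq_sub_of_hasDerivAt_of_le hr
    (continuousOn_kernel_primitive hγ hη)
    (fun u hu => hasDerivAt_kernel_primitive hγ hη hu.1.le hu.2)
    (intervalIntegrable_kernel hγ hη hr)]
  simp [Real.zero_rpow hγ.ne']

lemma continuousOn_shifted_rpow {η p b : ℝ} (hη : 0 < η) :
    ContinuousOn (fun u : ℝ => (u + η) ^ p) (Icc 0 b) :=
  ContinuousOn.rpow_const (by fun_prop) (fun u hu => Or.inl (by have := hu.1; positivity))

lemma integral_shifted_rpow_le {γ η δ : ℝ} (hγ : 0 < γ) (hη : 0 < η) (hδ : 0 ≤ δ) :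
    ∫ u in (0:ℝ)..δ, (u + η) ^ (-γ - 1) ≤ η ^ (-γ) / γ := by
  have hd : ∀ u ∈ uIcc 0 δ, HasDerivAt (fun u => -((u + η) ^ (-γ) / γ)) ((u + η) ^ (-γ - 1)) u := by
    intro u hu
    rw [uIcc_of_le hδ] at hu
    have hp : 0 < u + η := by linarith [hu.1]
    have h := ((((hasDerivAt_id u).add_const η).rpow_const (p := -γ)
      (Or.inl hp.ne')).div_const γ).neg
    refine h.congr_deriv ?_
    simp only [id]
    field_simp
  rw [intervalIntegral.integral_eq_sub_of_hasDerivAt hd]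
  · have : 0 ≤ (δ + η) ^ (-γ) / γ := by positivity
    simp only [zero_add]
    linarith
  · exact ContinuousOn.intervalIntegrable (by
      rw [uIcc_of_le hδ]; exact continuousOn_shifted_rpow hη)

lemma kernel_defect_le {γ η δ r : ℝ} (hγ : 0 < γ) (hη : 0 < η) (hδ : 0 ≤ δ)
    (hr : 0 < r) :
    (∫ u in (0:ℝ)..δ, (u + η) ^ (-γ - 1)) * r ^ (γ - 1)
      - ∫ u in (0:ℝ)..r, (r - u) ^ (γ - 1) * (u + η) ^ (-γ - 1)
      ≤ η ^ (1 - γ) * r ^ (γ - 1) / (γ * (r + η)) := by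
  rw [integral_kernel hγ hη hr.le]
  have h1 := mul_le_mul_of_nonneg_right (integral_shifted_rpow_le hγ hη hδ)
    (Real.rpow_nonneg hr.le (γ - 1))
  have h2 : η ^ (-γ) / γ * r ^ (γ - 1) - (r / η) ^ γ / (γ * (r + η))
      = η ^ (1 - γ) * r ^ (γ - 1) / (γ * (r + η)) := by
    rw [Real.div_rpow hr.le hη.le, Real.rpow_neg hη.le, Real.rpow_sub_one hr.ne',
      Real.rpow_sub hη, Real.rpow_one]
    have := (Real.rpow_pos_of_pos hη γ).ne'
    have : r + η ≠ 0 := by positivity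
    field_simp
    ring
  linarith

lemma integrableOn_rpow_div_one_add {γ : ℝ} (h0 : 0 < γ) (h1 : γ < 1) :
    IntegrableOn (fun r : ℝ => r ^ (γ - 1) / (r + 1)) (Ioi 0) := by
  have hm : Measurable (fun r : ℝ => r ^ (γ - 1) / (r + 1)) := by fun_prop
  rw [← Ioc_union_Ioi_eq_Ioi (zero_le_one' ℝ)]
  refine IntegrableOn.union ?_ ?_
  · have := (intervalIntegrable_iff_integrableOn_Ioc_of_le (zero_le_one' ℝ)).1
      (intervalIntegral.intervalIntegrable_rpow' (a := 0) (b := 1) (show -1 < γ - 1 by linarith))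
    refine Integrable.mono' this hm.aestronglyMeasurable ?_
    filter_upwards [ae_restrict_mem measurableSet_Ioc] with r hr
    have hr0 : 0 < r := hr.1
    rw [Real.norm_of_nonneg (by positivity)]
    exact div_le_self (by positivity) (by linarith)
  · refine Integrable.mono' (integrableOn_Ioi_rpow_of_lt (show γ - 2 < -1 by linarith) one_pos)
      hm.aestronglyMeasurable ?_
    filter_upwards [ae_restrict_mem measurableSet_Ioi] with r hr
    have hr0 : 0 < r := one_pos.trans hr
    rw [Real.norm_of_nonneg (by positivity), show γ - 2 = γ - 1 - 1 by ring,
      Real.rpow_sub_one hr0.ne' (γ - 1)]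
    exact div_le_div_of_nonneg_left (by positivity) hr0 (by linarith)

lemma integral_indicator_kernel {γ t₀ u : ℝ} (w : ℝ → ℝ) (hu : 0 ≤ u) (hut : u ≤ t₀) :
    ∫ r, (Ioc 0 t₀).indicator w r * (Ioc 0 t₀).indicator (fun s : ℝ => s ^ (γ - 1)) (r - u)
      = ∫ r in u..t₀, (r - u) ^ (γ - 1) * w r := by
  rw [intervalIntegral.integral_of_le hut, ← integral_indicator measurableSet_Ioc]
  congr 1
  funext r
  by_cases h : r ∈ Ioc u t₀
  · have h1 : r ∈ Ioc 0 t₀ := ⟨hu.trans_lt h.1, h.2⟩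
    have h2 : r - u ∈ Ioc 0 t₀ := ⟨sub_pos.2 h.1, by linarith [h.2]⟩
    rw [indicator_of_mem h, indicator_of_mem h1, indicator_of_mem h2, mul_comm]
  · rw [indicator_of_notMem h]
    by_cases h1 : r ∈ Ioc 0 t₀
    · have h2 : r - u ∉ Ioc 0 t₀ := fun h2 => h ⟨sub_pos.1 h2.1, h1.2⟩
      rw [indicator_of_notMem h2, mul_zero]
    · rw [indicator_of_notMem h1, zero_mul]

lemma truncated_kernel_defect_le {γ η δ t₀ r : ℝ} (hγ : 0 < γ) (hγ1 : γ < 1) (hη : 0 < η)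
    (hδ : 0 < δ) (hr : r ∈ Ioc 0 t₀) :
    (∫ u in (0:ℝ)..δ, (u + η) ^ (-γ - 1)) * r ^ (γ - 1)
      - ∫ u, (Ioc 0 δ).indicator (fun u : ℝ => (u + η) ^ (-γ - 1)) u
          * (Ioc 0 t₀).indicator (fun s : ℝ => s ^ (γ - 1)) (r - u)
      ≤ η⁻¹ / γ * ((η⁻¹ * r) ^ (γ - 1) / (η⁻¹ * r + 1)) := by
  have hr0 : 0 < r := hr.1
  have hB : η⁻¹ / γ * ((η⁻¹ * r) ^ (γ - 1) / (η⁻¹ * r + 1))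
      = η ^ (1 - γ) * r ^ (γ - 1) / (γ * (r + η)) := by
    rw [Real.mul_rpow (by positivity) hr0.le, Real.inv_rpow hη.le, ← Real.rpow_neg hη.le, neg_sub]
    field_simp
  rw [hB]
  rcases le_or_gt r δ with h | h
  · refine le_trans (le_of_eq ?_) (kernel_defect_le hγ hη hδ.le hr0)
    congr 1
    rw [intervalIntegral.integral_of_le hr0.le, integral_Ioc_eq_integral_Ioo,
      ← integral_indicator measurableSet_Ioo]
    congr 1
    funext u
    by_cases hu : u ∈ Ioo 0 r
    · have h1 : u ∈ Ioc 0 δ := ⟨hu.1, hu.2.le.trans h⟩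
      have h2 : r - u ∈ Ioc 0 t₀ := ⟨sub_pos.2 hu.2, by linarith [hu.1, hr.2]⟩
      rw [indicator_of_mem hu, indicator_of_mem h1, indicator_of_mem h2, mul_comm]
    · rw [indicator_of_notMem hu]
      by_cases h1 : u ∈ Ioc 0 δ
      · have h2 : r - u ∉ Ioc 0 t₀ := fun h2 => hu ⟨h1.1, sub_pos.1 h2.1⟩
        rw [indicator_of_notMem h2, mul_zero]
      · rw [indicator_of_notMem h1, zero_mul]
  · refine le_trans (b := 0) ?_ (by positivity)
    rw [sub_nonpos]
    have hN : ∫ u, (Ioc 0 δ).indicator (fun u : ℝ => (u + η) ^ (-γ - 1)) u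
          * (Ioc 0 t₀).indicator (fun s : ℝ => s ^ (γ - 1)) (r - u)
        = ∫ u in (0:ℝ)..δ, (u + η) ^ (-γ - 1) * (r - u) ^ (γ - 1) := by
      rw [intervalIntegral.integral_of_le hδ.le, ← integral_indicator measurableSet_Ioc]
      congr 1
      funext u
      by_cases h1 : u ∈ Ioc 0 δ
      · have h2 : r - u ∈ Ioc 0 t₀ := ⟨by linarith [h1.2], by linarith [h1.1, hr.2]⟩
        rw [indicator_of_mem h1, indicator_of_mem h1, indicator_of_mem h2]
      · rw [indicator_of_notMem h1, indicator_of_notMem h1, zero_mul]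
    rw [hN, ← intervalIntegral.integral_mul_const]
    have hc1 : ContinuousOn (fun u : ℝ => (u + η) ^ (-γ - 1)) (Icc 0 δ) :=
      continuousOn_shifted_rpow hη
    have hc2 : ContinuousOn (fun u : ℝ => (r - u) ^ (γ - 1)) (Icc 0 δ) :=
      ContinuousOn.rpow_const (by fun_prop) (fun u hu => Or.inl (by linarith [hu.2]))
    refine intervalIntegral.integral_mono_on hδ.le ?_ ?_ (fun u hu => ?_)
    · exact ContinuousOn.intervalIntegrable (by
        rw [uIcc_of_le hδ.le]; exact hc1.mul continuousOn_const)
    · exact ContinuousOn.intervalIntegrable (by rw [uIcc_of_le hδ.le]; exact hc1.mul hc2)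
    · have h1 : 0 ≤ u + η := by linarith [hu.1]
      exact mul_le_mul_of_nonneg_left
        (Real.rpow_le_rpow_of_nonpos (by linarith [hu.2]) (by linarith [hu.1]) (by linarith))
        (by positivity)

lemma integral_shifted_weight_le {γ η δ t₀ d M : ℝ} {w : ℝ → ℝ} (hγ : 0 < γ) (hγ1 : γ < 1)
    (hη : 0 < η) (hδ : 0 < δ) (hδt : δ ≤ t₀)
    (hwc : ContinuousOn w (Icc 0 t₀)) (hwn : ∀ r ∈ Icc 0 t₀, 0 ≤ w r)
    (hM : ∀ r ∈ Icc 0 t₀, w r ≤ M)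
    (h : ∀ u ∈ Ioc 0 δ, (∫ r in u..t₀, (r - u) ^ (γ - 1) * w r) + d * u
      ≤ ∫ r in (0:ℝ)..t₀, r ^ (γ - 1) * w r) :
    d * ∫ u in (0:ℝ)..δ, (u + η) ^ (-γ - 1) * u ≤
      ∫ r in Ioi (0:ℝ), (Ioc 0 t₀).indicator w (η * r) * (r ^ (γ - 1) / (r + 1)) / γ := by
  have ht₀ : 0 < t₀ := hδ.trans_le hδt
  set W := (Ioc 0 t₀).indicator w with hW
  set k := (Ioc 0 t₀).indicator (fun s : ℝ => s ^ (γ - 1)) with hk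
  set F := (Ioc 0 δ).indicator (fun u : ℝ => (u + η) ^ (-γ - 1)) with hF
  set c := ∫ u in (0:ℝ)..δ, (u + η) ^ (-γ - 1) with hc
  have hki : Integrable k := (integrable_indicator_iff measurableSet_Ioc).2
    ((intervalIntegrable_iff_integrableOn_Ioc_of_le ht₀.le).1
      (intervalIntegral.intervalIntegrable_rpow' (by linarith)))
  have hFi : Integrable F := (integrable_indicator_iff measurableSet_Ioc).2
    ((continuousOn_shifted_rpow hη).integrableOn_Icc.mono_set Ioc_subset_Icc_self)
  have hWm : AEStronglyMeasurable W volume :=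
    (aestronglyMeasurable_indicator_iff measurableSet_Ioc).2
      ((hwc.mono Ioc_subset_Icc_self).aestronglyMeasurable measurableSet_Ioc)
  have hM0 : 0 ≤ M := (hwn 0 ⟨le_rfl, ht₀.le⟩).trans (hM 0 ⟨le_rfl, ht₀.le⟩)
  have hWb : ∀ r, ‖W r‖ ≤ M := by
    intro r
    by_cases hr : r ∈ Ioc 0 t₀
    · rw [hW, indicator_of_mem hr, Real.norm_of_nonneg (hwn r (Ioc_subset_Icc_self hr))]
      exact hM r (Ioc_subset_Icc_self hr)
    · rw [hW, indicator_of_notMem hr, norm_zero]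
      exact hM0
  have hconv : Integrable (fun p : ℝ × ℝ => F p.2 * k (p.1 - p.2)) (volume.prod volume) := by
    simpa using Integrable.convolution_integrand (ContinuousLinearMap.mul ℝ ℝ) hFi hki
  have hΦ : Integrable (Function.uncurry fun r u => W r * (F u * k (r - u)))
      (volume.prod volume) := by
    have := hconv.bdd_mul (f := fun p : ℝ × ℝ => W p.1) (c := M) hWm.comp_fst
      (ae_of_all _ fun p => hWb p.1)
    exact this
  have hQ : ∀ u ∈ Icc 0 δ, ∫ r, W r * k (r - u) = ∫ r in u..t₀, (r - u) ^ (γ - 1) * w r :=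
    fun u hu => integral_indicator_kernel w hu.1 (hu.2.trans hδt)
  set Q := fun u => ∫ r, W r * k (r - u) with hQdef
  have hswap : ∫ r, W r * (∫ u, F u * k (r - u)) = ∫ u, F u * Q u := by
    have h1 := integral_integral_swap hΦ
    simp only [integral_const_mul] at h1
    rw [h1]
    congr 1
    funext u
    rw [hQdef, ← integral_const_mul]
    congr 1
    funext r
    ring
  have hFQ : Integrable (fun u => F u * Q u) := by
    have h1 := hΦ.integral_prod_right
    refine h1.congr (ae_of_all _ fun u => ?_)
    simp only [Function.uncurry, hQdef]
    rw [← integral_const_mul]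
    congr 1
    funext r
    ring
  have hWN : Integrable (fun r => W r * (∫ u, F u * k (r - u))) := by
    have h1 := hΦ.integral_prod_left
    refine h1.congr (ae_of_all _ fun r => ?_)
    simp only [Function.uncurry]
    rw [← integral_const_mul]
  have hWk : Integrable (fun r => W r * k r) := hki.bdd_mul hWm (ae_of_all _ hWb)
  have hcF : ∫ u, F u = c := by
    rw [hF, integral_indicator measurableSet_Ioc, hc, intervalIntegral.integral_of_le hδ.le]
  have hQ0 : Q 0 = ∫ r, W r * k r := by simp [hQdef]
  have hlow : d * ∫ u in (0:ℝ)..δ, (u + η) ^ (-γ - 1) * u ≤ c * Q 0 - ∫ u, F u * Q u := by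
    have e1 : c * Q 0 - ∫ u, F u * Q u = ∫ u, (F u * Q 0 - F u * Q u) := by
      rw [integral_sub (hFi.mul_const _) hFQ, integral_mul_const, hcF]
    have hci : IntegrableOn (fun u : ℝ => d * ((u + η) ^ (-γ - 1) * u)) (Ioc 0 δ) :=
      ((((continuousOn_shifted_rpow hη).mul continuousOn_id).integrableOn_Icc).mono_set
        Ioc_subset_Icc_self).const_mul d
    rw [e1, ← intervalIntegral.integral_const_mul, intervalIntegral.integral_of_le hδ.le,
      ← integral_indicator measurableSet_Ioc]
    refine integral_mono ((integrable_indicator_iff measurableSet_Ioc).2 hci)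
      ((hFi.mul_const _).sub hFQ) (fun u => ?_)
    by_cases hu : u ∈ Ioc 0 δ
    · have h1 := h u hu
      rw [← hQ u (Ioc_subset_Icc_self hu)] at h1
      have h2 := hQ 0 ⟨le_rfl, hδ.le⟩
      simp only [sub_zero] at h2
      rw [← h2] at h1
      have h3 : Q u + d * u ≤ Q 0 := by simpa [hQdef] using h1
      have hp : 0 ≤ u + η := by linarith [hu.1]
      have h4 : 0 ≤ (u + η) ^ (-γ - 1) := by positivity
      simp only [hF, indicator_of_mem hu]
      nlinarith
    · simp [hF, indicator_of_notMem hu]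
  refine hlow.trans ?_
  rw [hQ0, ← hswap, ← integral_const_mul, ← integral_sub (hWk.const_mul c) hWN]
  have hb := integrableOn_rpow_div_one_add hγ hγ1
  have hbi : IntegrableOn (fun r => η⁻¹ / γ * ((η⁻¹ * r) ^ (γ - 1) / (η⁻¹ * r + 1))) (Ioi 0) := by
    refine Integrable.const_mul ?_ _
    have := (integrableOn_Ioi_comp_mul_left_iff (fun r : ℝ => r ^ (γ - 1) / (r + 1)) 0
      (inv_pos.2 hη)).2 (by simpa using hb)
    exact this
  have hsub : ∫ r in Ioi (0:ℝ), W (η * r) * (r ^ (γ - 1) / (r + 1)) / γ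
      = ∫ r in Ioi (0:ℝ), W r * (η⁻¹ / γ * ((η⁻¹ * r) ^ (γ - 1) / (η⁻¹ * r + 1))) := by
    have h1 := integral_comp_mul_left_Ioi
      (fun r => W (η * r) * (r ^ (γ - 1) / (r + 1)) / γ) 0 (inv_pos.2 hη)
    rw [inv_inv, mul_zero, smul_eq_mul] at h1
    have h2 : ∫ r in Ioi (0:ℝ), W (η * r) * (r ^ (γ - 1) / (r + 1)) / γ
        = η⁻¹ * ∫ r in Ioi (0:ℝ), W (η * (η⁻¹ * r)) *
          ((η⁻¹ * r) ^ (γ - 1) / (η⁻¹ * r + 1)) / γ := by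
      rw [h1]; field_simp
    rw [h2, ← integral_const_mul]
    congr 1
    funext r
    rw [mul_inv_cancel_left₀ hη.ne']
    ring
  rw [hsub, ← integral_indicator measurableSet_Ioi]
  refine integral_mono ((hWk.const_mul c).sub hWN)
    ((integrable_indicator_iff measurableSet_Ioi).2
      (hbi.bdd_mul hWm.restrict (ae_of_all _ hWb))) (fun r => ?_)
  by_cases hr : r ∈ Ioc 0 t₀
  · have h1 := truncated_kernel_defect_le (t₀ := t₀) hγ hγ1 hη hδ hr
    rw [indicator_of_mem (show r ∈ Ioi (0:ℝ) from hr.1)]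
    have h2 : 0 ≤ W r := by
      rw [hW, indicator_of_mem hr]; exact hwn r (Ioc_subset_Icc_self hr)
    have h3 : k r = r ^ (γ - 1) := indicator_of_mem hr _
    have h4 := mul_le_mul_of_nonneg_left h1 h2
    calc c * (W r * k r) - W r * ∫ u, F u * k (r - u)
        = W r * (c * r ^ (γ - 1) - ∫ u, F u * k (r - u)) := by rw [h3]; ring
      _ ≤ _ := h4
  · have h2 : W r = 0 := indicator_of_notMem hr _
    have : (Ioi (0:ℝ)).indicator
        (fun r => W r * (η⁻¹ / γ * ((η⁻¹ * r) ^ (γ - 1) / (η⁻¹ * r + 1)))) r = 0 := by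
      by_cases h3 : r ∈ Ioi (0:ℝ)
      · rw [indicator_of_mem h3, h2, zero_mul]
      · exact indicator_of_notMem h3 _
    rw [this]
    simp [h2]

/-- A nonnegative continuous weight vanishing at `0` cannot have a fractional potential
that drops linearly at `0`. -/
lemma not_linear_drop_of_weight_zero {γ δ t₀ d : ℝ} {w : ℝ → ℝ} (hγ : 0 < γ) (hγ1 : γ < 1)
    (hδ : 0 < δ) (hδt : δ ≤ t₀) (hd : 0 < d)
    (hwc : ContinuousOn w (Icc 0 t₀)) (hwn : ∀ r ∈ Icc 0 t₀, 0 ≤ w r) (hw0 : w 0 = 0)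
    (h : ∀ u ∈ Ioc 0 δ, (∫ r in u..t₀, (r - u) ^ (γ - 1) * w r) + d * u
      ≤ ∫ r in (0:ℝ)..t₀, r ^ (γ - 1) * w r) : False := by
  have ht₀ : 0 < t₀ := hδ.trans_le hδt
  obtain ⟨M, hM⟩ := isCompact_Icc.exists_bound_of_continuousOn hwc
  have hM' : ∀ r ∈ Icc 0 t₀, w r ≤ M := fun r hr => (le_abs_self _).trans (hM r hr)
  have hM0 : 0 ≤ M := (norm_nonneg _).trans (hM 0 ⟨le_rfl, ht₀.le⟩)
  set W := (Ioc 0 t₀).indicator w with hW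
  have hWm : AEStronglyMeasurable W volume :=
    (aestronglyMeasurable_indicator_iff measurableSet_Ioc).2
      ((hwc.mono Ioc_subset_Icc_self).aestronglyMeasurable measurableSet_Ioc)
  have hWb : ∀ r, ‖W r‖ ≤ M := by
    intro r
    by_cases hr : r ∈ Ioc 0 t₀
    · rw [hW, indicator_of_mem hr]
      exact hM r (Ioc_subset_Icc_self hr)
    · rw [hW, indicator_of_notMem hr, norm_zero]
      exact hM0
  have hWlim : Tendsto W (nhdsWithin 0 (Ioi 0)) (nhds 0) := by
    have h1 : Tendsto w (nhdsWithin 0 (Ioc 0 t₀)) (nhds 0) := by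
      have := (hwc 0 ⟨le_rfl, ht₀.le⟩).mono Ioc_subset_Icc_self
      rwa [ContinuousWithinAt, hw0] at this
    rw [nhdsWithin_Ioc_eq_nhdsGT ht₀] at h1
    refine h1.congr' ?_
    filter_upwards [Ioc_mem_nhdsGT ht₀] with r hr
    rw [hW, indicator_of_mem hr]
  have hb := integrableOn_rpow_div_one_add hγ hγ1
  have hlim : Tendsto (fun η : ℝ => ∫ r in Ioi (0:ℝ), W (η * r) * (r ^ (γ - 1) / (r + 1)) / γ)
      (nhdsWithin 0 (Ioi 0)) (nhds (∫ r in Ioi (0:ℝ), (0:ℝ))) := by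
    refine tendsto_integral_filter_of_dominated_convergence
      (fun r => M * (r ^ (γ - 1) / (r + 1)) / γ) ?_ ?_ ((hb.const_mul M).div_const γ) ?_
    · filter_upwards [self_mem_nhdsWithin] with η hη
      have h1 : AEStronglyMeasurable (fun r => W (η * r)) volume :=
        hWm.comp_quasiMeasurePreserving (Measure.quasiMeasurePreserving_smul volume (ne_of_gt hη))
      have h2 := (h1.restrict.mul hb.aestronglyMeasurable).mul_const γ⁻¹
      simp only [div_eq_mul_inv _ γ]
      exact h2
    · filter_upwards with η
      filter_upwards [ae_restrict_mem measurableSet_Ioi] with r hr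
      have hr0 : (0:ℝ) < r := hr
      have h2 : 0 ≤ r ^ (γ - 1) / (r + 1) := by positivity
      rw [norm_div, norm_mul, Real.norm_of_nonneg h2, Real.norm_of_nonneg hγ.le]
      gcongr
      exact hWb _
    · filter_upwards [ae_restrict_mem measurableSet_Ioi] with r hr
      have hr0 : (0:ℝ) < r := hr
      have h2 : Tendsto (fun η : ℝ => η * r) (nhdsWithin 0 (Ioi 0)) (nhdsWithin 0 (Ioi 0)) := by
        refine tendsto_nhdsWithin_iff.2 ⟨?_, ?_⟩
        · have : Tendsto (fun η : ℝ => η * r) (nhds 0) (nhds (0 * r)) :=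
            tendsto_id.mul_const r
          rw [zero_mul] at this
          exact this.mono_left nhdsWithin_le_nhds
        · filter_upwards [self_mem_nhdsWithin] with η hη
          exact mul_pos hη hr0
      have h3 := ((hWlim.comp h2).mul_const (r ^ (γ - 1) / (r + 1))).div_const γ
      simpa using h3
  rw [integral_zero] at hlim
  set e := d * ((2 * δ) ^ (-γ - 1) * (δ ^ 2 / 2)) with he
  have he0 : 0 < e := by positivity
  have hev := hlim.eventually (gt_mem_nhds he0)
  obtain ⟨η, hη, hηδ⟩ := (hev.and (Ioc_mem_nhdsGT hδ)).exists
  have hη0 : 0 < η := hηδ.1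
  have hmain := integral_shifted_weight_le hγ hγ1 hη0 hδ hδt hwc hwn hM' h
  have hlow : (2 * δ) ^ (-γ - 1) * (δ ^ 2 / 2) ≤ ∫ u in (0:ℝ)..δ, (u + η) ^ (-γ - 1) * u := by
    have h1 : (2 * δ) ^ (-γ - 1) * (δ ^ 2 / 2) = ∫ u in (0:ℝ)..δ, (2 * δ) ^ (-γ - 1) * u := by
      rw [intervalIntegral.integral_const_mul, integral_id]
      ring
    rw [h1]
    refine intervalIntegral.integral_mono_on hδ.le (Continuous.intervalIntegrable (by fun_prop) _ _)
      (ContinuousOn.intervalIntegrable (by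
        rw [uIcc_of_le hδ.le]; exact (continuousOn_shifted_rpow hη0).mul continuousOn_id))
      (fun u hu => ?_)
    exact mul_le_mul_of_nonneg_right (Real.rpow_le_rpow_of_nonpos (by linarith [hu.1])
      (by linarith [hu.2, hηδ.2]) (by linarith)) hu.1
  have := mul_le_mul_of_nonneg_left hlow hd.le
  linarith

lemma intervalIntegrable_fracInt_kernel {γ t : ℝ} {z : ℝ → ℝ} (hγ : 0 < γ) (ht : 0 ≤ t)
    (hz : ContinuousOn z (Icc 0 t)) :
    IntervalIntegrable (fun s => (t - s) ^ (γ - 1) * z s) volume 0 t := by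
  have h1 := ((intervalIntegral.intervalIntegrable_rpow' (a := 0) (b := t)
    (show -1 < γ - 1 by linarith)).comp_sub_left t).symm
  simp only [sub_zero, sub_self] at h1
  exact h1.mul_continuousOn (by rwa [uIcc_of_le ht])

lemma integral_fracInt_kernel {γ t : ℝ} (hγ : 0 < γ) :
    ∫ s in (0:ℝ)..t, (t - s) ^ (γ - 1) = t ^ γ / γ := by
  rw [intervalIntegral.integral_comp_sub_left (fun s => s ^ (γ - 1)) t,
    integral_rpow (Or.inl (by linarith))]
  simp [Real.zero_rpow hγ.ne']

/-- At a nonnegative running maximum of a continuous function, the derivative of its fractional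
integral of order in `(0, 1)` is nonnegative, if it exists. -/
lemma nonneg_of_hasDerivAt_fracInt {γ t₀ D : ℝ} {z : ℝ → ℝ} (hγ : 0 < γ) (hγ1 : γ < 1)
    (ht₀ : 0 < t₀) (hz : ContinuousOn z (Icc 0 t₀)) (hmax : ∀ s ∈ Icc 0 t₀, z s ≤ z t₀)
    (h0 : 0 ≤ z t₀) (hD : HasDerivAt (fracInt γ z) D t₀) : 0 ≤ D := by
  by_contra! hneg
  have hΓ := Real.Gamma_pos_of_pos hγ
  have hlo := (hasDerivAt_iff_isLittleO.1 hD).def (show 0 < -D / 2 by linarith)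
  obtain ⟨δ₀, hδ₀, hball⟩ := Metric.eventually_nhds_iff.1 hlo
  set w : ℝ → ℝ := fun r => z t₀ - z (t₀ - r) with hw
  have hQ : ∀ u ∈ Ico 0 t₀, ∫ r in u..t₀, (r - u) ^ (γ - 1) * w r
      = z t₀ * ((t₀ - u) ^ γ / γ) - Real.Gamma γ * fracInt γ z (t₀ - u) := by
    intro u hu
    have h1 := intervalIntegral.integral_comp_sub_left
      (fun s => (t₀ - u - s) ^ (γ - 1) * (z t₀ - z s)) t₀ (a := u) (b := t₀)
    rw [sub_self] at h1
    have h2 : ∫ r in u..t₀, (r - u) ^ (γ - 1) * w r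
        = ∫ x in u..t₀, (t₀ - u - (t₀ - x)) ^ (γ - 1) * (z t₀ - z (t₀ - x)) := by
      congr 1
      funext r
      rw [hw]
      ring_nf
    have hu0 : 0 ≤ t₀ - u := by linarith [hu.2]
    have hzu : ContinuousOn z (Icc 0 (t₀ - u)) := hz.mono (Icc_subset_Icc_right (by linarith [hu.1]))
    rw [h2, h1]
    have h3 : ∀ s, (t₀ - u - s) ^ (γ - 1) * (z t₀ - z s)
        = (t₀ - u - s) ^ (γ - 1) * z t₀ - (t₀ - u - s) ^ (γ - 1) * z s := fun s => by ring
    simp only [h3]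
    rw [intervalIntegral.integral_sub
      (intervalIntegrable_fracInt_kernel hγ hu0 continuousOn_const)
      (intervalIntegrable_fracInt_kernel hγ hu0 hzu), intervalIntegral.integral_mul_const,
      integral_fracInt_kernel hγ, fracInt]
    field_simp
  set δ := min (δ₀ / 2) (t₀ / 2) with hδ
  have hδpos : 0 < δ := lt_min (by linarith) (by linarith)
  have hδ1 : δ ≤ δ₀ / 2 := min_le_left _ _
  have hδ2 : δ ≤ t₀ / 2 := min_le_right _ _
  have hrefl : MapsTo (fun r => t₀ - r) (Icc 0 t₀) (Icc 0 t₀) :=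
    fun r hr => ⟨by linarith [hr.2], by linarith [hr.1]⟩
  refine not_linear_drop_of_weight_zero (w := w) (d := Real.Gamma γ * (-D / 2)) hγ hγ1 hδpos
    (by linarith : δ ≤ t₀) (mul_pos hΓ (by linarith))
    (continuousOn_const.sub (hz.comp (by fun_prop) hrefl))
    (fun r hr => sub_nonneg.2 (hmax _ (hrefl hr))) (by simp [hw]) (fun u hu => ?_)
  have hQ0 := hQ 0 ⟨le_rfl, ht₀⟩
  simp only [sub_zero] at hQ0
  rw [hQ0, hQ u ⟨hu.1.le, by linarith [hu.2]⟩]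
  have h4 : dist (t₀ - u) t₀ < δ₀ := by
    rw [Real.dist_eq, sub_sub_cancel_left, abs_neg, abs_of_pos hu.1]
    linarith [hu.2]
  have h5 := hball h4
  rw [sub_sub_cancel_left, norm_neg, smul_eq_mul, Real.norm_eq_abs, Real.norm_of_nonneg hu.1.le]
    at h5
  have h6 := (abs_le.1 h5).1
  have h7 : (t₀ - u) ^ γ ≤ t₀ ^ γ :=
    Real.rpow_le_rpow (by linarith [hu.2]) (by linarith [hu.1]) hγ.le
  have h8 : z t₀ * ((t₀ - u) ^ γ / γ) ≤ z t₀ * (t₀ ^ γ / γ) := by gcongr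
  have h9 : Real.Gamma γ * (-D / 2 * u) ≤
      Real.Gamma γ * (fracInt γ z (t₀ - u) - fracInt γ z t₀) :=
    mul_le_mul_of_nonneg_left (by linarith) hΓ.le
  linarith

lemma lipschitz_extension_of_deriv {u u' : ℝ → ℝ} (hu : ContinuousOn u (Ici 0))
    (hu' : ContinuousOn u' (Ici 0)) (hd : ∀ t > 0, HasDerivAt u (u' t) t) (M : ℝ) :
    ∃ K : ℝ, 0 ≤ K ∧ ∀ a ≤ M, ∀ b ≤ M, |u (max a 0) - u (max b 0)| ≤ K * |a - b| := by
  obtain ⟨K, hK⟩ := isCompact_Icc.exists_bound_of_continuousOn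
    (hu'.mono (Icc_subset_Ici_self : Icc 0 M ⊆ Ici 0))
  have key : ∀ a b, 0 ≤ a → a < b → b ≤ M → |u b - u a| ≤ max K 0 * (b - a) := by
    intro a b ha hab hb
    obtain ⟨c, hc, hc'⟩ := exists_hasDerivAt_eq_slope u u' hab
      (hu.mono fun x hx => ha.trans hx.1) (fun x hx => hd x (ha.trans_lt hx.1))
    have h1 := hK c ⟨ha.trans hc.1.le, hc.2.le.trans hb⟩
    have hba : 0 < b - a := by linarith
    rw [hc', Real.norm_eq_abs, abs_div, abs_of_pos hba, div_le_iff₀ hba] at h1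
    exact h1.trans (by gcongr; exact le_max_left _ _)
  have key' : ∀ a b, 0 ≤ a → 0 ≤ b → a ≤ max M 0 → b ≤ max M 0 →
      |u a - u b| ≤ max K 0 * |a - b| := by
    intro a b ha hb haM hbM
    rcases lt_trichotomy a b with h | h | h
    · have hM : b ≤ M := (le_max_iff.1 hbM).resolve_right (by linarith)
      rw [abs_sub_comm, abs_sub_comm a, abs_of_pos (sub_pos.2 h)]
      exact key a b ha h hM
    · simp [h]
    · have hM : a ≤ M := (le_max_iff.1 haM).resolve_right (by linarith)
      rw [abs_of_pos (sub_pos.2 h)]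
      exact key b a hb h hM
  refine ⟨max K 0, le_max_right _ _, fun a ha b hb => ?_⟩
  refine (key' _ _ (le_max_right _ _) (le_max_right _ _) (max_le_max_right _ ha)
    (max_le_max_right _ hb)).trans ?_
  exact mul_le_mul_of_nonneg_left (abs_max_sub_max_le_abs a b 0) (le_max_right _ _)

lemma integral_fracInt_kernel_eq_extension {γ τ M : ℝ} {u : ℝ → ℝ} (hγ : 0 < γ) (hτ : 0 ≤ τ)
    (hτM : τ ≤ M) (hu : ContinuousOn u (Ici 0)) :
    ∫ s in (0:ℝ)..τ, (τ - s) ^ (γ - 1) * u s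
      = u 0 * (τ ^ γ / γ) + ∫ s in (0:ℝ)..M, s ^ (γ - 1) * (u (max (τ - s) 0) - u 0) := by
  have hext : Continuous (fun s : ℝ => u (max (τ - s) 0) - u 0) :=
    (hu.comp_continuous (by fun_prop) (fun s => mem_Ici.2 (le_max_right _ _))).sub continuous_const
  have hint : ∀ a b, IntervalIntegrable
      (fun s => s ^ (γ - 1) * (u (max (τ - s) 0) - u 0)) volume a b := fun a b =>
    (intervalIntegral.intervalIntegrable_rpow' (by linarith)).mul_continuousOn hext.continuousOn
  rw [← intervalIntegral.integral_add_adjacent_intervals (hint 0 τ) (hint τ M)]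
  have h1 : ∫ s in τ..M, s ^ (γ - 1) * (u (max (τ - s) 0) - u 0) = 0 := by
    rw [intervalIntegral.integral_congr (g := fun _ => 0), intervalIntegral.integral_zero]
    intro s hs
    rw [uIcc_of_le hτM] at hs
    simp [max_eq_right (sub_nonpos.2 hs.1)]
  have h2 : ∫ s in (0:ℝ)..τ, s ^ (γ - 1) * (u (max (τ - s) 0) - u 0)
      = ∫ s in (0:ℝ)..τ, (τ - s) ^ (γ - 1) * (u s - u 0) := by
    have h3 := intervalIntegral.integral_comp_sub_left
      (fun s => (τ - s) ^ (γ - 1) * (u s - u 0)) τ (a := 0) (b := τ)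
    rw [sub_self, sub_zero] at h3
    rw [← h3]
    refine intervalIntegral.integral_congr (fun s hs => ?_)
    rw [uIcc_of_le hτ] at hs
    simp [max_eq_left (sub_nonneg.2 hs.2)]
  have h4 : ∀ s, (τ - s) ^ (γ - 1) * (u s - u 0)
      = (τ - s) ^ (γ - 1) * u s - (τ - s) ^ (γ - 1) * u 0 := fun s => by ring
  rw [h1, h2]
  simp only [h4]
  rw [intervalIntegral.integral_sub
    (intervalIntegrable_fracInt_kernel hγ hτ (hu.mono Icc_subset_Ici_self))
    (intervalIntegrable_fracInt_kernel hγ hτ continuousOn_const),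
    intervalIntegral.integral_mul_const, integral_fracInt_kernel hγ]
  ring

lemma hasDerivAt_fracInt {γ t : ℝ} {u u' : ℝ → ℝ} (hγ : 0 < γ) (hu : ContinuousOn u (Ici 0))
    (hu' : ContinuousOn u' (Ici 0)) (hd : ∀ t > 0, HasDerivAt u (u' t) t) (ht : 0 < t) :
    HasDerivAt (fracInt γ u) (u 0 / Real.Gamma γ * t ^ (γ - 1) + fracInt γ u' t) t := by
  set M := t + 1 with hM
  have hMt : t < M := by linarith
  have hM0 : 0 < M := by linarith
  obtain ⟨K, hK0, hK⟩ := lipschitz_extension_of_deriv hu hu' hd M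
  have hext : ∀ τ : ℝ, Continuous (fun s : ℝ => u (max (τ - s) 0) - u 0) := fun τ =>
    (hu.comp_continuous (by fun_prop) (fun s => mem_Ici.2 (le_max_right _ _))).sub continuous_const
  have hext' : Continuous (fun s : ℝ => u' (max (t - s) 0)) :=
    hu'.comp_continuous (by fun_prop) (fun s => mem_Ici.2 (le_max_right _ _))
  have hpow : IntervalIntegrable (fun s : ℝ => s ^ (γ - 1)) volume 0 M :=
    intervalIntegral.intervalIntegrable_rpow' (by linarith)
  have hpm : Measurable (fun s : ℝ => s ^ (γ - 1)) := by fun_prop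
  have hmain := intervalIntegral.hasDerivAt_integral_of_dominated_loc_of_lip (μ := volume)
    (a := 0) (b := M) (x₀ := t) (s := Iio M) (bound := fun s => s ^ (γ - 1) * K)
    (F := fun τ s => s ^ (γ - 1) * (u (max (τ - s) 0) - u 0))
    (F' := fun s => s ^ (γ - 1) * (Iio t).indicator (fun s => u' (max (t - s) 0)) s)
    (Iio_mem_nhds hMt)
    (Eventually.of_forall fun τ => (hpm.mul (hext τ).measurable).aestronglyMeasurable)
    (hpow.mul_continuousOn (hext t).continuousOn)
    (hpm.mul (hext'.measurable.indicator measurableSet_Iio)).aestronglyMeasurable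
    (ae_of_all _ fun s hs => ?_) (hpow.mul_const K) ?_
  · have heq : fracInt γ u =ᶠ[nhds t] fun τ => 1 / Real.Gamma γ * (u 0 * (τ ^ γ / γ)
        + ∫ s in (0:ℝ)..M, s ^ (γ - 1) * (u (max (τ - s) 0) - u 0)) := by
      filter_upwards [Ioo_mem_nhds ht hMt] with τ hτ
      rw [fracInt, integral_fracInt_kernel_eq_extension hγ hτ.1.le hτ.2.le hu]
    have h1 : HasDerivAt (fun τ : ℝ => τ ^ γ / γ) (t ^ (γ - 1)) t := by
      refine ((Real.hasDerivAt_rpow_const (p := γ) (Or.inl ht.ne')).div_const γ).congr_deriv ?_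
      field_simp
    refine ((((h1.const_mul (u 0)).add hmain.2).const_mul (1 / Real.Gamma γ)).congr_of_eventuallyEq
      heq).congr_deriv ?_
    have h2 : ∫ s in (0:ℝ)..M, s ^ (γ - 1) * (Iio t).indicator (fun s => u' (max (t - s) 0)) s
        = ∫ s in (0:ℝ)..t, (t - s) ^ (γ - 1) * u' s := by
      have hsplit := intervalIntegral.integral_add_adjacent_intervals
        (hmain.1.mono_set (uIcc_subset_uIcc left_mem_uIcc
          (by rw [uIcc_of_le hM0.le]; exact ⟨ht.le, hMt.le⟩)) : IntervalIntegrable _ _ 0 t)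
        (hmain.1.mono_set (uIcc_subset_uIcc
          (by rw [uIcc_of_le hM0.le]; exact ⟨ht.le, hMt.le⟩) right_mem_uIcc) :
          IntervalIntegrable _ _ t M)
      have hz : ∫ s in t..M, s ^ (γ - 1) * (Iio t).indicator (fun s => u' (max (t - s) 0)) s
          = 0 := by
        rw [intervalIntegral.integral_congr (g := fun _ => 0), intervalIntegral.integral_zero]
        intro s hs
        rw [uIcc_of_le hMt.le] at hs
        have : s ∉ Iio t := not_lt.2 hs.1
        simp [indicator_of_notMem this]
      have h3 := intervalIntegral.integral_comp_sub_left
        (fun s => (t - s) ^ (γ - 1) * u' s) t (a := 0) (b := t)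
      rw [sub_self, sub_zero] at h3
      rw [← hsplit, hz, add_zero, ← h3, intervalIntegral.integral_of_le ht.le,
        intervalIntegral.integral_of_le ht.le, integral_Ioc_eq_integral_Ioo,
        integral_Ioc_eq_integral_Ioo]
      refine setIntegral_congr_fun measurableSet_Ioo (fun s hs => ?_)
      have : s ∈ Iio t := hs.2
      simp [indicator_of_mem this, max_eq_left (sub_nonneg.2 hs.2.le)]
    rw [h2, fracInt]
    ring
  · rw [uIoc_of_le hM0.le] at hs
    have hs0 : 0 < s := hs.1
    have hb : 0 ≤ s ^ (γ - 1) * K := by positivity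
    refine LipschitzOnWith.of_dist_le_mul (fun a ha b hb' => ?_)
    have h1 := hK (a - s) (by have : a < M := ha; linarith) (b - s)
      (by have : b < M := hb'; linarith)
    rw [Real.coe_nnabs, abs_of_nonneg hb, Real.dist_eq, Real.dist_eq, ← mul_sub, abs_mul,
      abs_of_nonneg (Real.rpow_nonneg hs0.le _), sub_sub_sub_cancel_right, mul_assoc]
    rw [sub_sub_sub_cancel_right] at h1
    gcongr
  · have hne : ∀ᵐ s : ℝ, s ≠ t := by
      simp [ae_iff]
    filter_upwards [hne] with s hst _
    refine HasDerivAt.const_mul _ ?_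
    rcases lt_or_gt_of_ne hst with h | h
    · rw [indicator_of_mem (show s ∈ Iio t from h), max_eq_left (sub_nonneg.2 h.le)]
      have h1 : HasDerivAt (fun τ => u (τ - s) - u 0) (u' (t - s)) t := by
        have := (hd (t - s) (sub_pos.2 h)).comp_sub_const t s
        exact this.sub_const _
      refine h1.congr_of_eventuallyEq ?_
      filter_upwards [Ioi_mem_nhds h] with τ hτ
      rw [max_eq_left (sub_nonneg.2 (le_of_lt hτ))]
    · rw [indicator_of_notMem (show s ∉ Iio t from not_lt.2 h.le)]
      refine (hasDerivAt_const t (0:ℝ)).congr_of_eventuallyEq ?_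
      filter_upwards [Iio_mem_nhds h] with τ hτ
      rw [max_eq_right (sub_nonpos.2 (le_of_lt hτ)), sub_self]

lemma iteratedDeriv_fracInt {γ : ℝ} {w : ℕ → ℝ → ℝ} {N : ℕ} (hγ : 0 < γ)
    (hc : ∀ k ≤ N, ContinuousOn (w k) (Ici 0))
    (hd : ∀ k < N, ∀ t > 0, HasDerivAt (w k) (w (k + 1) t) t) :
    ∀ k ≤ N, ∃ c : ℕ → ℝ, ∀ t > 0, iteratedDeriv k (fracInt γ (w 0)) t
      = ∑ j ∈ Finset.range k, c j * t ^ (γ - 1 - j) + fracInt γ (w k) t := by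
  intro k
  induction k with
  | zero => exact fun _ => ⟨fun _ => 0, fun t _ => by simp⟩
  | succ k ih =>
    intro hk
    obtain ⟨c, hcf⟩ := ih (by omega)
    refine ⟨fun j => j.casesOn (w k 0 / Real.Gamma γ) fun i => c i * (γ - 1 - i), fun t ht => ?_⟩
    have h1 : iteratedDeriv k (fracInt γ (w 0)) =ᶠ[nhds t]
        fun t => ∑ j ∈ Finset.range k, c j * t ^ (γ - 1 - j) + fracInt γ (w k) t := by
      filter_upwards [Ioi_mem_nhds ht] with τ hτ using hcf τ hτ
    have h2 : HasDerivAt (fun t : ℝ => ∑ j ∈ Finset.range k, c j * t ^ (γ - 1 - j))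
        (∑ j ∈ Finset.range k, c j * ((γ - 1 - j) * t ^ (γ - 1 - j - 1))) t :=
      HasDerivAt.fun_sum fun j _ => (Real.hasDerivAt_rpow_const (Or.inl ht.ne')).const_mul _
    have h3 := hasDerivAt_fracInt hγ (hc k (by omega)) (hc (k + 1) hk) (hd k (by omega)) ht
    rw [iteratedDeriv_succ, h1.deriv_eq, (h2.fun_add h3).deriv, Finset.sum_range_succ', ← add_assoc]
    congr 1
    congr 1
    · refine Finset.sum_congr rfl fun j _ => ?_
      push_cast
      rw [show γ - 1 - ((j : ℝ) + 1) = γ - 1 - j - 1 by ring]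
      ring
    · simp

lemma fracInt_rpow {γ κ t : ℝ} (ht : 0 < t) :
    fracInt γ (fun s => s ^ κ) t = fracInt γ (fun s => s ^ κ) 1 * t ^ (γ + κ) := by
  have h := intervalIntegral.integral_comp_mul_right
    (fun s => (t - s) ^ (γ - 1) * s ^ κ) ht.ne' (a := 0) (b := 1)
  rw [zero_mul, one_mul, smul_eq_mul, eq_inv_mul_iff_mul_eq₀ ht.ne'] at h
  rw [fracInt, fracInt, ← h]
  have h2 : ∫ s in (0:ℝ)..1, (t - s * t) ^ (γ - 1) * (s * t) ^ κ
      = (∫ s in (0:ℝ)..1, (1 - s) ^ (γ - 1) * s ^ κ) * t ^ (γ - 1 + κ) := by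
    rw [← intervalIntegral.integral_mul_const]
    refine intervalIntegral.integral_congr fun s hs => ?_
    rw [uIcc_of_le zero_le_one] at hs
    rw [show t - s * t = (1 - s) * t by ring, Real.mul_rpow (sub_nonneg.2 hs.2) ht.le,
      Real.mul_rpow hs.1 ht.le, Real.rpow_add ht]
    ring
  rw [h2, show γ + κ = γ - 1 + κ + 1 by ring, Real.rpow_add_one ht.ne']
  ring

lemma deriv_fracInt_ge {γ κ ε t₀ : ℝ} {v : ℝ → ℝ} (hγ : 0 < γ) (hγ1 : γ < 1) (hκ : 0 < κ)
    (ht₀ : 0 < t₀) (hv : ContinuousOn v (Ici 0))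
    (hmax : ∀ s ∈ Icc 0 t₀, v s + ε * s ^ κ ≤ v t₀ + ε * t₀ ^ κ) (h0 : 0 ≤ v t₀ + ε * t₀ ^ κ)
    (hd : DifferentiableAt ℝ (fracInt γ v) t₀) :
    -(ε * ((γ + κ) * fracInt γ (fun s => s ^ κ) 1) * t₀ ^ (γ + κ - 1))
      ≤ deriv (fracInt γ v) t₀ := by
  set B := fracInt γ (fun s => s ^ κ) 1 with hB
  have hp : Continuous fun s : ℝ => s ^ κ := Real.continuous_rpow_const hκ.le
  have h1 : fracInt γ (fun s => v s + ε * s ^ κ) =ᶠ[nhds t₀]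
      fun t => fracInt γ v t + ε * (B * t ^ (γ + κ)) := by
    filter_upwards [Ioi_mem_nhds ht₀] with t ht
    rw [hB, ← fracInt_rpow ht]
    simp only [fracInt, mul_add]
    rw [intervalIntegral.integral_add
      (intervalIntegrable_fracInt_kernel hγ (le_of_lt ht) (hv.mono Icc_subset_Ici_self))
      (intervalIntegrable_fracInt_kernel hγ (le_of_lt ht) (hp.const_mul ε).continuousOn)]
    have h2 : ∀ s, (t - s) ^ (γ - 1) * (ε * s ^ κ) = ε * ((t - s) ^ (γ - 1) * s ^ κ) :=
      fun s => by ring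
    simp only [h2]
    rw [intervalIntegral.integral_const_mul]
    ring
  have h2 := (hd.hasDerivAt.add (((Real.hasDerivAt_rpow_const (p := γ + κ)
    (Or.inl ht₀.ne')).const_mul B).const_mul ε)).congr_of_eventuallyEq h1
  have h3 := nonneg_of_hasDerivAt_fracInt hγ hγ1 ht₀
    ((hv.mono Icc_subset_Ici_self).add (hp.const_mul ε).continuousOn) hmax h0 h2
  linarith

/-- If `w` is a chain of derivatives and `w N` perturbed by `ε * s ^ κ` has a nonnegative running
maximum at `t₀`, then the derivative of order `N + 1` of the fractional integral of `w 0` is bounded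
below at `t₀` (recall that `deriv` vanishes at points of nondifferentiability). -/
lemma iteratedDeriv_succ_fracInt_ge {γ κ : ℝ} {w : ℕ → ℝ → ℝ} {N : ℕ} (hγ : 0 ≤ γ) (hγ1 : γ < 1)
    (hκ : 0 < κ) (hc : ∀ k ≤ N, ContinuousOn (w k) (Ici 0))
    (hd : ∀ k < N, ∀ t > 0, HasDerivAt (w k) (w (k + 1) t) t) :
    ∃ C ≥ 0, ∃ K ≥ 0, ∀ ε > 0, ∀ t₀ ≥ 1,
      (∀ s ∈ Icc 0 t₀, w N s + ε * s ^ κ ≤ w N t₀ + ε * t₀ ^ κ) → 0 ≤ w N t₀ + ε * t₀ ^ κ →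
      -(C * t₀ ^ (γ - 2) + ε * K * t₀ ^ (γ + κ - 1))
        ≤ iteratedDeriv (N + 1) (fracInt γ (w 0)) t₀ := by
  rcases hγ.eq_or_lt with rfl | hγ
  · refine ⟨0, le_rfl, 0, le_rfl, fun ε _ t₀ _ _ _ => ?_⟩
    have : fracInt 0 (w 0) = fun _ => 0 := by
      funext t
      simp [fracInt]
    rw [this]
    simp
  obtain ⟨c, hcf⟩ := iteratedDeriv_fracInt hγ hc hd N le_rfl
  have hB : 0 ≤ fracInt γ (fun s => s ^ κ) 1 := by
    refine mul_nonneg (one_div_nonneg.2 (Real.Gamma_pos_of_pos hγ).le)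
      (intervalIntegral.integral_nonneg zero_le_one fun s hs => ?_)
    have h1 : 0 ≤ 1 - s := by linarith [hs.2]
    have h2 := hs.1
    positivity
  refine ⟨∑ j ∈ Finset.range N, |c j * (γ - 1 - j)|, Finset.sum_nonneg fun _ _ => abs_nonneg _,
    (γ + κ) * fracInt γ (fun s => s ^ κ) 1, by positivity, fun ε hε t₀ ht₀ hmax h0 => ?_⟩
  have ht : 0 < t₀ := by linarith
  set p : ℝ → ℝ := fun t => ∑ j ∈ Finset.range N, c j * t ^ (γ - 1 - j) with hp
  have h1 : iteratedDeriv N (fracInt γ (w 0)) =ᶠ[nhds t₀] fun t => p t + fracInt γ (w N) t := by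
    filter_upwards [Ioi_mem_nhds ht] with τ hτ using hcf τ hτ
  have h2 : HasDerivAt p
      (∑ j ∈ Finset.range N, c j * ((γ - 1 - j) * t₀ ^ (γ - 1 - j - 1))) t₀ :=
    HasDerivAt.fun_sum fun j _ => (Real.hasDerivAt_rpow_const (Or.inl ht.ne')).const_mul _
  rw [iteratedDeriv_succ, h1.deriv_eq]
  by_cases hdiff : DifferentiableAt ℝ (fracInt γ (w N)) t₀
  · rw [(h2.fun_add hdiff.hasDerivAt).deriv, neg_add]
    refine add_le_add ?_ (deriv_fracInt_ge hγ hγ1 hκ ht (hc N le_rfl) hmax h0 hdiff)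
    rw [Finset.sum_mul, ← Finset.sum_neg_distrib]
    refine Finset.sum_le_sum fun j _ => ?_
    rw [← mul_assoc, neg_le, ← neg_mul]
    have h3 : t₀ ^ (γ - 1 - j - 1) ≤ t₀ ^ (γ - 2) :=
      Real.rpow_le_rpow_of_exponent_le ht₀ (by linarith [(Nat.cast_nonneg j : (0:ℝ) ≤ j)])
    exact mul_le_mul (neg_le_abs _) h3 (by positivity) (abs_nonneg _)
  · rw [deriv_zero_of_not_differentiableAt]
    · have h4 : 0 ≤ ∑ j ∈ Finset.range N, |c j * (γ - 1 - j)| :=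
        Finset.sum_nonneg fun _ _ => abs_nonneg _
      rw [neg_nonpos]
      positivity
    · intro h
      exact hdiff (((h.sub h2.differentiableAt)).congr_of_eventuallyEq
        (Eventually.of_forall fun t => by simp))

lemma bddAbove_of_no_running_max {z : ℝ → ℝ} {T : ℝ} (hz : ContinuousOn z (Ici 0))
    (h : ∀ t₀ ≥ T, 0 ≤ z t₀ → ¬ ∀ s ∈ Icc 0 t₀, z s ≤ z t₀) : ∃ M, ∀ t ≥ 0, z t ≤ M := by
  obtain ⟨M, hM⟩ := isCompact_Icc.bddAbove_image (hz.mono (Icc_subset_Ici_self : Icc 0 T ⊆ Ici 0))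
  refine ⟨max M 0, fun t ht => ?_⟩
  obtain ⟨s, hs, hsmax⟩ := isCompact_Icc.exists_isMaxOn (nonempty_Icc.2 ht)
    (hz.mono (Icc_subset_Ici_self : Icc 0 t ⊆ Ici 0))
  refine (hsmax ⟨ht, le_rfl⟩).trans ?_
  rcases le_or_gt s T with hsT | hsT
  · exact (hM ⟨s, ⟨hs.1, hsT⟩, rfl⟩).trans (le_max_left _ _)
  · refine le_trans ?_ (le_max_right _ _)
    by_contra! hpos
    exact h s hsT.le hpos.le fun r hr => hsmax ⟨hr.1, hr.2.trans hs.2⟩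

lemma tendsto_atBot_of_hasDerivAt {F F' : ℝ → ℝ} (hd : ∀ t > 0, HasDerivAt F (F' t) t)
    (h : Tendsto F' atTop atBot) : Tendsto F atTop atBot := by
  obtain ⟨T, hT⟩ := eventually_atTop.1 ((h.eventually_le_atBot (-1)).and (eventually_gt_atTop 0))
  have hT0 : 0 < T := (hT T le_rfl).2
  refine tendsto_atBot_mono' atTop (f₁ := fun t => F T + T - t) ?_
    (tendsto_atBot_add_const_left _ (F T + T) tendsto_neg_atTop_atBot)
  filter_upwards [eventually_ge_atTop T] with t ht
  have := (convex_Ici T).image_sub_le_mul_sub_of_deriv_le (f := F) (C := -1)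
    (fun s hs => (hd s (hT0.trans_le hs)).continuousAt.continuousWithinAt)
    (fun s hs => (hd s (hT0.trans_le (interior_subset hs))).differentiableAt.differentiableWithinAt)
    (fun s hs => by
      rw [(hd s (hT0.trans_le (interior_subset hs))).deriv]
      exact (hT s (interior_subset hs)).1) T self_mem_Ici t ht ht
  linarith

lemma hasDerivAt_iteratedDerivWithin_Ici {x : ℝ → ℝ} {N k : ℕ} {t : ℝ}
    (hx : ContDiffOn ℝ N x (Ici 0)) (hk : k < N) (ht : 0 < t) :
    HasDerivAt (iteratedDerivWithin k x (Ici 0)) (iteratedDerivWithin (k + 1) x (Ici 0) t) t := by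
  have h := (hx.differentiableOn_iteratedDerivWithin (by exact_mod_cast hk)
    (uniqueDiffOn_Ici 0) t ht.le).hasDerivWithinAt
  rw [iteratedDerivWithin_succ]
  exact h.hasDerivAt (Ici_mem_nhds ht)

lemma tendsto_atBot_of_iteratedDerivWithin {x : ℝ → ℝ} {N : ℕ} (hx : ContDiffOn ℝ N x (Ici 0))
    (h : Tendsto (iteratedDerivWithin N x (Ici 0)) atTop atBot) : Tendsto x atTop atBot := by
  suffices ∀ j ≤ N, Tendsto (iteratedDerivWithin (N - j) x (Ici 0)) atTop atBot by
    simpa using this N le_rfl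
  intro j
  induction j with
  | zero => simpa using h
  | succ j ih =>
    intro hj
    refine tendsto_atBot_of_hasDerivAt
      (fun t ht => hasDerivAt_iteratedDerivWithin_Ici hx (by omega) ht) ?_
    rw [show N - (j + 1) + 1 = N - j by omega]
    exact ih (by omega)

/-- The remainder after subtracting the Taylor polynomial at `0` admits a chain of derivatives on
the half-line whose last member differs from the corresponding derivative by a constant. -/
lemma exists_taylor_remainder_chain {x : ℝ → ℝ} {N : ℕ} (hx : ContDiffOn ℝ N x (Ici 0)) :
    ∃ w : ℕ → ℝ → ℝ, (w 0 = fun s => x s - taylorPolyAt0 (N + 1) x s) ∧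
      (∀ k ≤ N, ContinuousOn (w k) (Ici 0)) ∧
      (∀ k < N, ∀ t > 0, HasDerivAt (w k) (w (k + 1) t) t) ∧
      ∃ b, ∀ t, iteratedDerivWithin N x (Ici 0) t = w N t + b := by
  set p : Polynomial ℝ := ∑ k ∈ Finset.range (N + 1),
    Polynomial.C (iteratedDeriv k x 0 / (Nat.factorial k : ℝ)) * Polynomial.X ^ k with hp
  refine ⟨fun k t => iteratedDerivWithin k x (Ici 0) t - (Polynomial.derivative^[k] p).eval t,
    ?_, fun k hk => ?_, fun k hk t ht => ?_, ?_⟩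
  · funext s
    simp [hp, taylorPolyAt0, Polynomial.eval_finsetSum]
  · exact (hx.continuousOn_iteratedDerivWithin (by exact_mod_cast hk) (uniqueDiffOn_Ici 0)).sub
      (Polynomial.continuous _).continuousOn
  · have h1 := (Polynomial.derivative^[k] p).hasDerivAt t
    rw [← Function.iterate_succ_apply' (f := Polynomial.derivative)] at h1
    exact (hasDerivAt_iteratedDerivWithin_Ici hx hk ht).sub h1
  · have hdeg : p.natDegree ≤ N := Polynomial.natDegree_sum_le_of_forall_le _ _ fun k hk =>
      (Polynomial.natDegree_C_mul_X_pow_le _ _).trans (by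
        have := Finset.mem_range.1 hk
        omega)
    have h0 : (Polynomial.derivative^[N] p).natDegree = 0 := by
      have := Polynomial.natDegree_iterate_derivative p N
      omega
    refine ⟨(Polynomial.derivative^[N] p).coeff 0, fun t => ?_⟩
    have h1 := congrArg (Polynomial.eval t) (Polynomial.eq_C_of_natDegree_eq_zero h0)
    rw [Polynomial.eval_C] at h1
    simp only [h1, sub_add_cancel]

lemma caputoD_eq_iteratedDeriv {γ : ℝ} {x : ℝ → ℝ} {N : ℕ} {w : ℝ → ℝ} (h : ⌈γ⌉₊ = N + 1)
    (hw : w = fun s => x s - taylorPolyAt0 (N + 1) x s) :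
    caputoD γ x = iteratedDeriv (N + 1) (fracInt ((N + 1 : ℕ) - γ) w) := by
  rw [caputoD, h, hw]

/-- A function whose combined Caputo derivatives of orders `β < α` in `(N, N + 1]` are eventually at
most `-c * t ^ (N + 1 - β - σ)`, where `N + 1 - β < σ < 1`, tends to `-∞`. -/
lemma tendsto_atBot_of_caputoD_le {N : ℕ} {α β a σ c T : ℝ} {x : ℝ → ℝ}
    (hN : (N : ℝ) < β) (hβα : β < α) (hα : α ≤ (N + 1 : ℕ)) (ha : 0 < a)
    (hσ : ((N + 1 : ℕ) : ℝ) - β < σ) (hσ1 : σ < 1) (hc : 0 < c)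
    (hx : ContDiffOn ℝ N x (Ici 0))
    (h : ∀ t ≥ T, caputoD α x t + a * caputoD β x t ≤ -(c * t ^ (((N + 1 : ℕ) : ℝ) - β - σ))) :
    Tendsto x atTop atBot := by
  have hcα : ⌈α⌉₊ = N + 1 := (Nat.ceil_eq_iff (by omega)).2 ⟨by simpa using hN.trans hβα, hα⟩
  have hcβ : ⌈β⌉₊ = N + 1 :=
    (Nat.ceil_eq_iff (by omega)).2 ⟨by simpa using hN, (hβα.le.trans hα)⟩
  obtain ⟨w, hw0, hwc, hwd, b, hb⟩ := exists_taylor_remainder_chain hx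
  rw [caputoD_eq_iteratedDeriv hcα hw0, caputoD_eq_iteratedDeriv hcβ hw0] at h
  push_cast at h hσ hα
  set γ : ℝ := N + 1 - β with hγ
  set κ : ℝ := 1 - σ with hκ
  have hκ0 : 0 < κ := by linarith
  obtain ⟨C₁, hC₁, K₁, hK₁, h₁⟩ := iteratedDeriv_succ_fracInt_ge (γ := N + 1 - α) (κ := κ)
    (by linarith) (by linarith) hκ0 hwc hwd
  obtain ⟨C₂, hC₂, K₂, hK₂, h₂⟩ := iteratedDeriv_succ_fracInt_ge (γ := γ) (κ := κ)
    (by linarith) (by linarith) hκ0 hwc hwd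
  set C := C₁ + a * C₂ with hC
  set K := K₁ + a * K₂ with hK
  have hC0 : 0 ≤ C := by positivity
  have hK0 : 0 ≤ K := by positivity
  obtain ⟨ε, hε, hεK⟩ : ∃ ε > 0, ε * K ≤ c / 2 := by
    refine ⟨c / 2 / (K + 1), by positivity, ?_⟩
    rw [div_mul_eq_mul_div, div_le_iff₀ (by positivity)]
    nlinarith
  obtain ⟨T', hT'⟩ : ∃ T', ∀ t ≥ T', 2 * C < c * t ^ (2 - σ) := by
    have := (tendsto_rpow_atTop (show 0 < 2 - σ by linarith)).const_mul_atTop hc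
    exact eventually_atTop.1 (this.eventually_gt_atTop _)
  obtain ⟨M, hM⟩ := bddAbove_of_no_running_max (z := fun s => w N s + ε * s ^ κ)
    (T := max (max T T') 1)
    ((hwc N le_rfl).add ((Real.continuous_rpow_const hκ0.le).const_mul ε).continuousOn)
    (fun t₀ ht₀ h0 hmax => by
      have hT : T ≤ t₀ := (le_max_left _ _).trans ((le_max_left _ _).trans ht₀)
      have hT₂ : T' ≤ t₀ := (le_max_right _ _).trans ((le_max_left _ _).trans ht₀)
      have ht1 : 1 ≤ t₀ := (le_max_right _ _).trans ht₀
      have ht : 0 < t₀ := by linarith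
      have e₁ := h₁ ε hε t₀ ht1 hmax h0
      have e₂ := mul_le_mul_of_nonneg_left (h₂ ε hε t₀ ht1 hmax h0) ha.le
      have e₃ := h t₀ hT
      have p₁ : t₀ ^ ((N + 1 : ℝ) - α - 2) ≤ t₀ ^ (γ - 2) :=
        Real.rpow_le_rpow_of_exponent_le ht1 (by linarith)
      have p₂ : t₀ ^ ((N + 1 : ℝ) - α + κ - 1) ≤ t₀ ^ (γ - σ) :=
        Real.rpow_le_rpow_of_exponent_le ht1 (by linarith)
      rw [show γ + κ - 1 = γ - σ by rw [hκ]; ring] at e₂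
      have q₁ := mul_le_mul_of_nonneg_left p₁ hC₁
      have q₂ := mul_le_mul_of_nonneg_left p₂ (mul_nonneg hε.le hK₁)
      have q₃ : 2 * C * t₀ ^ (γ - 2) < c * t₀ ^ (γ - σ) := by
        rw [show γ - σ = (2 - σ) + (γ - 2) by ring, Real.rpow_add ht, ← mul_assoc]
        exact mul_lt_mul_of_pos_right (hT' t₀ hT₂) (by positivity)
      have q₄ := mul_le_mul_of_nonneg_right hεK (Real.rpow_nonneg ht.le (γ - σ))
      rw [hC] at q₃
      rw [hK] at q₄
      linarith)
  refine tendsto_atBot_of_iteratedDerivWithin hx ?_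
  refine tendsto_atBot_mono' atTop (f₁ := fun t => M + b - ε * t ^ κ) ?_
    (tendsto_atBot_add_const_left _ (M + b)
      (tendsto_neg_atTop_atBot.comp ((tendsto_rpow_atTop hκ0).const_mul_atTop hε)))
  filter_upwards [eventually_ge_atTop 0] with t ht
  have := hM t ht
  rw [hb]
  linarith

/-- for even `n`, under the sign pattern (c) the limit of `y_1`
at infinity exists and is finite. -/
theorem stmt19
    (n : ℕ) (hn3 : 3 ≤ n) (heven : Even n)
    (α β a : ℝ)
    (hβ : (n : ℝ) - 1 < β) (hβα : β < α) (hceil : ⌈α⌉₊ = n)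
    (ha : 0 < a)
    (f : ℝ → ℝ) (q g : ℝ → ℝ)
    (hfc : Continuous f) (hqc : ContinuousOn q (Set.Ici 0))
    (hgc : ContinuousOn g (Set.Ici 0))
    (hG1 : ∀ u : ℝ, u ≠ 0 → 0 < u * f u)
    (hG2 : ∃ c₁ > (0:ℝ), ∃ η > (0:ℝ), ∀ u : ℝ, 1 ≤ |u| → c₁ * |u| ^ η ≤ |f u|)
    (hG3 : ∃ c₂ > (0:ℝ), ∃ μ : ℝ, 0 < μ ∧ μ < ((n : ℝ) - 2) / ((n : ℝ) - β) ∧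
      ∀ u : ℝ, |u| < 1 → c₂ * |u| ^ μ ≤ |f u|)
    (hH : ∃ T₁ > (0:ℝ), ∃ c₃ > (0:ℝ), ∀ t ≥ T₁, c₃ ≤ q t)
    (hK : ∃ σ : ℝ, (n : ℝ) - β < σ ∧ σ < 1 ∧
      ∃ c₄ > (0:ℝ), ∃ T₂ > (0:ℝ), ∀ t ≥ T₂, c₄ * t ^ ((n : ℝ) - β - σ) ≤ g t)
    (ξ : ℕ → ℝ) (x : ℝ → ℝ)
    (hx : ContCaputoDiffOnIci α x)
    (heq : ∀ t > (0:ℝ),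
      caputoD α x t + a * caputoD β x t + q t * f (x t) + Real.sign (x t) * g t = 0)
    (hinit : ∀ i < n, iteratedDeriv i x 0 = ξ i)
    (hxpos : ∃ T > (0:ℝ), ∀ t ≥ T, 0 < x t)
    (hsign : ∃ T > (0:ℝ), ∀ t ≥ T, 0 < assocY n α β a ξ x 1 t ∧
      0 < assocY n α β a ξ x 2 t ∧
      ∀ i, 3 ≤ i → i ≤ n → 0 < (-1 : ℝ) ^ i * assocY n α β a ξ x i t) :
    ∃ L : ℝ, Filter.Tendsto (assocY n α β a ξ x 1) Filter.atTop (nhds L) := by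
  exfalso
  obtain ⟨N, rfl⟩ : ∃ N, n = N + 1 := ⟨n - 1, by omega⟩
  obtain ⟨σ, hσ, hσ1, c, hc, T₂, -, hg⟩ := hK
  obtain ⟨T₁, -, c₃, hc₃, hq⟩ := hH
  obtain ⟨T, hT, hpos⟩ := hxpos
  have hNβ : (N : ℝ) < β := by
    push_cast at hβ
    linarith
  have hx' : ContDiffOn ℝ N x (Ici 0) := by
    have := hx.1
    rwa [hceil, Nat.add_sub_cancel] at this
  have hlim := tendsto_atBot_of_caputoD_le (T := max T (max T₁ T₂)) hNβ
    hβα (hceil ▸ Nat.le_ceil α) ha hσ hσ1 hc hx'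
    (fun t ht => by
      have h1 : T ≤ t := (le_max_left _ _).trans ht
      have h2 : T₁ ≤ t := (le_max_left _ _).trans ((le_max_right _ _).trans ht)
      have h3 : T₂ ≤ t := (le_max_right _ _).trans ((le_max_right _ _).trans ht)
      have hxt := hpos t h1
      have hf : 0 < f (x t) := pos_of_mul_pos_right (hG1 _ hxt.ne') hxt.le
      have he := heq t (hT.trans_le h1)
      rw [Real.sign_of_pos hxt, one_mul] at he
      have := mul_pos (hc₃.trans_le (hq t h2)) hf
      have := hg t h3
      linarith)
  obtain ⟨t, ht, ht'⟩ := ((hlim.eventually_lt_atBot 0).and (eventually_ge_atTop T)).exists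
  exact (hpos t ht').not_gt ht
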